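/- arXiv:2005.07822 — 8 statements merged into one kernel-verified Lean document; each statement's English description precedes it below -/
import Mathlib

section
/- Let n ≥ 1, let S ⊆ ℝⁿ be a nonempty, compact, convex set with 0 ∉ S, let W ∈ ℝ^{n×n} be symmetric positive definite, and let β ∈ (0,1). Then there exist ς > 0 and δ > 0 such that for all u, v ∈ S satisfying ‖u‖_W ≤ (1+ς)·(inf_{s∈S} ‖s‖_W) + δ, one has vᵀWu > β‖u‖_W². -/
open Matrix

/-- Expansion of a symmetric quadratic form along the segment from `u` to `v`. -/
theorem Matrix.IsSymm.dotProduct_mulVec_add_smul_sub {ι R : Type*} [Fintype ι] [CommRing R]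
    {W : Matrix ι ι R} (hW : W.IsSymm) (u v : ι → R) (t : R) :
    (u + t • (v - u)) ⬝ᵥ W *ᵥ (u + t • (v - u)) =
      u ⬝ᵥ W *ᵥ u + 2 * t * (v ⬝ᵥ W *ᵥ u - u ⬝ᵥ W *ᵥ u)
        + t ^ 2 * ((v - u) ⬝ᵥ W *ᵥ (v - u)) := by
  have hsymm : u ⬝ᵥ W *ᵥ v = v ⬝ᵥ W *ᵥ u := by
    rw [dotProduct_mulVec, ← mulVec_transpose, hW.eq, dotProduct_comm]
  simp only [mulVec_add, mulVec_smul, mulVec_sub, add_dotProduct, dotProduct_add,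
    smul_dotProduct, dotProduct_smul, sub_dotProduct, dotProduct_sub, smul_eq_mul, hsymm]
  ring

/-- Lemma 2.2 (angle lemma): for a nonempty compact convex set `S` not containing the
origin, a symmetric positive definite `W`, and `β ∈ (0,1)`, there exist `ς, δ > 0` such
that any `u ∈ S` whose `W`-norm is at most `(1+ς) · inf_{s∈S} ‖s‖_W + δ` satisfies
`vᵀWu > β ‖u‖_W²` for every `v ∈ S`. -/
theorem stmt_0 {n : ℕ} (hn : 1 ≤ n) (S : Set (Fin n → ℝ)) (hne : S.Nonempty)
    (hcpt : IsCompact S) (hconv : Convex ℝ S) (h0 : (0 : Fin n → ℝ) ∉ S)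
    (W : Matrix (Fin n) (Fin n) ℝ) (hW : W.PosDef)
    (β : ℝ) (hβ : β ∈ Set.Ioo (0 : ℝ) 1) :
    ∃ ς > (0 : ℝ), ∃ δ > (0 : ℝ), ∀ u ∈ S, ∀ v ∈ S,
      Real.sqrt (u ⬝ᵥ W.mulVec u)
        ≤ (1 + ς) * sInf ((fun s => Real.sqrt (s ⬝ᵥ W.mulVec s)) '' S) + δ →
      v ⬝ᵥ W.mulVec u > β * (u ⬝ᵥ W.mulVec u) := by
  obtain ⟨hβ0, hβ1⟩ := hβ
  have hsymm : W.IsSymm := by simpa [IsHermitian, IsSymm] using hW.isHermitian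
  have hcont : Continuous fun s : Fin n → ℝ => s ⬝ᵥ W *ᵥ s := by fun_prop
  obtain ⟨w, hwS, hwmin⟩ := hcpt.exists_isMinOn hne hcont.sqrt.continuousOn
  have hinf : sInf ((fun s => √(s ⬝ᵥ W *ᵥ s)) '' S) = √(w ⬝ᵥ W *ᵥ w) :=
    IsLeast.csInf_eq ⟨Set.mem_image_of_mem _ hwS, Set.forall_mem_image.2 fun _ hs => hwmin hs⟩
  have hnonneg (s : Fin n → ℝ) : 0 ≤ s ⬝ᵥ W *ᵥ s := by
    simpa using hW.posSemidef.dotProduct_mulVec_nonneg s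
  have hwpos : 0 < w ⬝ᵥ W *ᵥ w := by
    simpa using hW.dotProduct_mulVec_pos (x := w) fun h => h0 (h ▸ hwS)
  rw [hinf]
  set m := √(w ⬝ᵥ W *ᵥ w) with hm
  have hmpos : 0 < m := Real.sqrt_pos.2 hwpos
  have hmin (s : Fin n → ℝ) (hs : s ∈ S) : m ^ 2 ≤ s ⬝ᵥ W *ᵥ s :=
    (Real.le_sqrt' hmpos).1 (hwmin hs)
  obtain ⟨C, hC⟩ := (hcpt.prod hcpt).bddAbove_image
    (f := fun p : (Fin n → ℝ) × (Fin n → ℝ) => (p.2 - p.1) ⬝ᵥ W *ᵥ (p.2 - p.1))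
    (hcont.comp (continuous_snd.sub continuous_fst)).continuousOn
  set D := max C (m ^ 2)
  have hDpos : 0 < D := lt_max_of_lt_right (by positivity)
  set t := (1 - β) * m ^ 2 / D with ht
  have htpos : 0 < t := div_pos (mul_pos (by linarith) (by positivity)) hDpos
  have ht1 : t ≤ 1 := by
    rw [ht, div_le_one hDpos]
    have : m ^ 2 ≤ D := le_max_right _ _
    nlinarith [sq_nonneg m]
  have htD : t * D = (1 - β) * m ^ 2 := div_mul_cancel₀ _ hDpos.ne'
  set r := √(m ^ 2 + t * ((1 - β) * m ^ 2)) with hr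
  have hmr : m < r := by
    rw [hr, Real.lt_sqrt hmpos.le]
    have : 0 < t * ((1 - β) * m ^ 2) := by rw [← htD]; positivity
    linarith
  refine ⟨(r - m) / (4 * m), div_pos (by linarith) (by positivity), (r - m) / 4, by linarith, ?_⟩
  intro u hu v hv hle
  by_contra! hcon
  have hnear : √(u ⬝ᵥ W *ᵥ u) < r := by
    have : (1 + (r - m) / (4 * m)) * m + (r - m) / 4 = m + (r - m) / 2 := by
      field_simp
      ring
    linarith
  have hfar : r ≤ √(u ⬝ᵥ W *ᵥ u) := by
    apply Real.sqrt_le_sqrt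
    have hseg := hmin _ (hconv.add_smul_sub_mem hu hv ⟨htpos.le, ht1⟩)
    rw [hsymm.dotProduct_mulVec_add_smul_sub] at hseg
    have hdiam : (v - u) ⬝ᵥ W *ᵥ (v - u) ≤ D :=
      (hC (Set.mem_image_of_mem _ (Set.mk_mem_prod hu hv))).trans (le_max_left _ _)
    have hquad : t ^ 2 * ((v - u) ⬝ᵥ W *ᵥ (v - u)) ≤ t * ((1 - β) * m ^ 2) := by
      rw [← htD, ← mul_assoc, ← sq]
      gcongr
    have hlin : v ⬝ᵥ W *ᵥ u - u ⬝ᵥ W *ᵥ u ≤ -((1 - β) * m ^ 2) := by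
      nlinarith [hmin u hu]
    nlinarith [mul_le_mul_of_nonneg_left hlin htpos.le]
  exact hfar.not_gt hnear
end

section
/- Let H ∈ ℝ^{n×n} be symmetric positive definite with inverse W := H⁻¹, let G ∈ ℝ^{n×m} (m ≥ 1) have columns g₁,…,g_m, and let y* ∈ Δ_m be a minimizer of y ↦ (Gy)ᵀW(Gy) over Δ_m. Set d* := −WGy*. Then ‖d*‖_H = ‖Gy*‖_W, and for every i ∈ {1,…,m} one has gᵢᵀd* ≤ −d*ᵀHd*. Moreover, if 0 ∉ conv{g₁,…,g_m}, then d* ≠ 0, so that gᵢᵀd* ≤ −d*ᵀHd* < 0 for every i (in particular, d* is a direction of strict descent with respect to each column of G). -/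
open Matrix

/-- First-order optimality along a segment: if `u` minimizes the quadratic form of a symmetric
matrix `W` on the segment from `u` to `v`, then `uᵀWu ≤ vᵀWu`. -/
lemma Matrix.IsSymm.dotProduct_mulVec_le_of_forall_segment {ι : Type*} [Fintype ι]
    {W : Matrix ι ι ℝ} (hW : W.IsSymm) (u v : ι → ℝ)
    (h : ∀ t : ℝ, 0 ≤ t → t ≤ 1 →
      u ⬝ᵥ W *ᵥ u ≤ ((1 - t) • u + t • v) ⬝ᵥ W *ᵥ ((1 - t) • u + t • v)) :
    u ⬝ᵥ W *ᵥ u ≤ v ⬝ᵥ W *ᵥ u := by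
  have hsymm : u ⬝ᵥ W *ᵥ v = v ⬝ᵥ W *ᵥ u := by
    rw [dotProduct_mulVec, ← mulVec_transpose, hW.eq, dotProduct_comm]
  have hquad : ∀ t : ℝ, 0 ≤ t → t ≤ 1 →
      0 ≤ t * (2 * (v ⬝ᵥ W *ᵥ u - u ⬝ᵥ W *ᵥ u)
        + t * (u ⬝ᵥ W *ᵥ u - 2 * (v ⬝ᵥ W *ᵥ u) + v ⬝ᵥ W *ᵥ v)) := by
    intro t ht0 ht1
    have ht := h t ht0 ht1
    simp only [mulVec_add, mulVec_smul, dotProduct_add, add_dotProduct, smul_dotProduct,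
      dotProduct_smul, smul_eq_mul, hsymm] at ht
    linarith
  generalize u ⬝ᵥ W *ᵥ u = a at *
  generalize v ⬝ᵥ W *ᵥ u = b at *
  generalize v ⬝ᵥ W *ᵥ v = c at *
  by_contra! hlt
  have hpos : 0 < a - b + |a - 2 * b + c| := by linarith [abs_nonneg (a - 2 * b + c)]
  set t := (a - b) / (a - b + |a - 2 * b + c|) with ht_def
  have ht0 : 0 < t := div_pos (by linarith) hpos
  have ht1 : t ≤ 1 := (div_le_one hpos).2 (by linarith [abs_nonneg (a - 2 * b + c)])
  have hle := nonneg_of_mul_nonneg_right (hquad t ht0.le ht1) ht0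
  have hmul : t * (a - b + |a - 2 * b + c|) = a - b := div_mul_cancel₀ _ hpos.ne'
  have hbound : t * (a - 2 * b + c) ≤ t * |a - 2 * b + c| :=
    mul_le_mul_of_nonneg_left (le_abs_self _) ht0.le
  have := mul_pos ht0 (sub_pos.2 hlt)
  linarith

/-- The image of the simplex under `G` lies in the convex hull of the columns of `G`. -/
lemma Matrix.mulVec_mem_convexHull_range_transpose {ι κ : Type*} [Fintype κ]
    (G : Matrix ι κ ℝ) {y : κ → ℝ} (hy : y ∈ stdSimplex ℝ κ) :
    G *ᵥ y ∈ convexHull ℝ (Set.range fun i : κ => Gᵀ i) := by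
  simp only [mulVec_eq_sum, op_smul_eq_smul]
  refine (convex_convexHull ℝ (Set.range fun i : κ => Gᵀ i)).sum_mem
    (fun i _ => hy.1 i) hy.2 fun i _ => ?_
  exact subset_convexHull ℝ _ ⟨i, rfl⟩

/-- Lemma 2.1: properties of the exact QP solution. With `y*` a minimizer of
`y ↦ (Gy)ᵀW(Gy)` over the unit simplex and `d* = -W G y*`, one has
`‖d*‖_H = ‖Gy*‖_W`, each column `gᵢ` of `G` satisfies `gᵢᵀd* ≤ -d*ᵀHd*`, and if the
origin is not in the convex hull of the columns of `G` then `d* ≠ 0` and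
`gᵢᵀd* ≤ -d*ᵀHd* < 0` for every `i`. -/
theorem stmt_2 {n m : ℕ} (hm : 1 ≤ m) (H W : Matrix (Fin n) (Fin n) ℝ)
    (hH : H.PosDef) (hW : W = H⁻¹) (G : Matrix (Fin n) (Fin m) ℝ)
    (ystar : Fin m → ℝ) (hy : ystar ∈ stdSimplex ℝ (Fin m))
    (hmin : ∀ y ∈ stdSimplex ℝ (Fin m),
      G.mulVec ystar ⬝ᵥ W.mulVec (G.mulVec ystar) ≤ G.mulVec y ⬝ᵥ W.mulVec (G.mulVec y))
    (dstar : Fin n → ℝ) (hd : dstar = -(W.mulVec (G.mulVec ystar))) :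
    Real.sqrt (dstar ⬝ᵥ H.mulVec dstar)
        = Real.sqrt (G.mulVec ystar ⬝ᵥ W.mulVec (G.mulVec ystar)) ∧
    (∀ i : Fin m, Gᵀ i ⬝ᵥ dstar ≤ -(dstar ⬝ᵥ H.mulVec dstar)) ∧
    ((0 : Fin n → ℝ) ∉ convexHull ℝ (Set.range fun i : Fin m => Gᵀ i) →
      dstar ≠ 0 ∧ -(dstar ⬝ᵥ H.mulVec dstar) < 0) := by
  have hdet : IsUnit H.det := (Matrix.isUnit_iff_isUnit_det H).1 hH.isUnit
  have hHsymm : H.IsSymm := hH.isHermitian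
  have hWsymm : W.IsSymm := by
    rw [hW, IsSymm, transpose_nonsing_inv, hHsymm.eq]
  have hHd : H *ᵥ dstar = -(G *ᵥ ystar) := by
    rw [hd, hW, mulVec_neg, mulVec_mulVec, mul_nonsing_inv _ hdet, one_mulVec]
  have hval : dstar ⬝ᵥ H *ᵥ dstar = G *ᵥ ystar ⬝ᵥ W *ᵥ (G *ᵥ ystar) := by
    rw [hHd, hd, neg_dotProduct_neg, dotProduct_comm]
  refine ⟨by rw [hval], fun i => ?_, fun h0 => ?_⟩
  · rw [hval, hd, dotProduct_neg, neg_le_neg_iff]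
    refine hWsymm.dotProduct_mulVec_le_of_forall_segment _ _ fun t ht0 ht1 => ?_
    have hmem : (1 - t) • ystar + t • Pi.single i 1 ∈ stdSimplex ℝ (Fin m) :=
      convex_stdSimplex ℝ (Fin m) hy (single_mem_stdSimplex ℝ i) (sub_nonneg.2 ht1) ht0
        (sub_add_cancel 1 t)
    have hle := hmin _ hmem
    rwa [mulVec_add, mulVec_smul, mulVec_smul, mulVec_single_one] at hle
  · have hne : dstar ≠ 0 := by
      rintro rfl
      rw [mulVec_zero, zero_eq_neg] at hHd
      exact h0 (hHd ▸ G.mulVec_mem_convexHull_range_transpose hy)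
    exact ⟨hne, neg_neg_of_pos (by simpa using hH.dotProduct_mulVec_pos hne)⟩
end

section
/- Let H ∈ ℝ^{n×n} be symmetric positive definite with inverse W := H⁻¹, let G ∈ ℝ^{n×m} (m ≥ 1) have columns g₁,…,g_m, and let y* ∈ Δ_m be a minimizer of y ↦ (Gy)ᵀW(Gy) over Δ_m. Then d* := −WGy* is the unique minimizer over d ∈ ℝⁿ of the piecewise quadratic function φ(d) := max_{1≤i≤m} gᵢᵀd + ½dᵀHd, and φ(d*) = −½(Gy*)ᵀW(Gy*). -/
open Matrix

theorem nonneg_of_forall_mul_add_sq_mul_nonneg {a b : ℝ}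
    (h : ∀ t : ℝ, 0 < t → t ≤ 1 → 0 ≤ 2 * t * a + t ^ 2 * b) : 0 ≤ a := by
  by_contra! ha
  have hb : 0 < |b| + 1 := by positivity
  set t : ℝ := min 1 (-a / (|b| + 1))
  have ht0 : 0 < t := lt_min one_pos (div_pos (neg_pos.2 ha) hb)
  have hle : t * (|b| + 1) ≤ -a := (le_div_iff₀ hb).1 (min_le_right _ _)
  have hq : 0 ≤ t * (2 * a + t * b) := by linarith [h t ht0 (min_le_left _ _)]
  have hlin : 0 ≤ 2 * a + t * b := nonneg_of_mul_nonneg_right hq ht0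
  nlinarith [mul_le_mul_of_nonneg_left (le_abs_self b) ht0.le]

theorem Matrix.IsSymm.dotProduct_mulVec_comm {ι : Type*} [Fintype ι] {A : Matrix ι ι ℝ}
    (hA : A.IsSymm) (x y : ι → ℝ) : x ⬝ᵥ A *ᵥ y = y ⬝ᵥ A *ᵥ x := by
  rw [dotProduct_mulVec, ← mulVec_transpose, hA.eq, dotProduct_comm]

/-- First-order optimality condition for a quadratic form minimized over a convex set. -/
theorem Matrix.IsSymm.le_dotProduct_mulVec_of_isMinOn {ι : Type*} [Fintype ι]
    {A : Matrix ι ι ℝ} (hA : A.IsSymm) {s : Set (ι → ℝ)} (hs : Convex ℝ s) {p q : ι → ℝ}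
    (hp : p ∈ s) (hq : q ∈ s) (hmin : IsMinOn (fun x => x ⬝ᵥ A *ᵥ x) s p) :
    p ⬝ᵥ A *ᵥ p ≤ q ⬝ᵥ A *ᵥ p := by
  have key : 0 ≤ (q - p) ⬝ᵥ A *ᵥ p := by
    refine nonneg_of_forall_mul_add_sq_mul_nonneg (b := (q - p) ⬝ᵥ A *ᵥ (q - p))
      fun t ht0 ht1 => ?_
    have h : p ⬝ᵥ A *ᵥ p ≤ (p + t • (q - p)) ⬝ᵥ A *ᵥ (p + t • (q - p)) :=
      hmin (hs.add_smul_sub_mem hp hq ⟨ht0.le, ht1⟩)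
    have hsymm := hA.dotProduct_mulVec_comm p (q - p)
    simp only [mulVec_add, mulVec_smul, dotProduct_add, add_dotProduct, smul_dotProduct,
      dotProduct_smul, smul_eq_mul, hsymm] at h
    linarith
  rw [sub_dotProduct] at key
  linarith

theorem dotProduct_le_iSup_of_mem_stdSimplex {ι : Type*} [Fintype ι] {y : ι → ℝ}
    (hy : y ∈ stdSimplex ℝ ι) (f : ι → ℝ) : y ⬝ᵥ f ≤ ⨆ i, f i :=
  calc y ⬝ᵥ f ≤ ∑ i, y i * ⨆ j, f j := Finset.sum_le_sum fun i _ =>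
        mul_le_mul_of_nonneg_left (le_ciSup (Set.finite_range f).bddAbove i) (hy.1 i)
    _ = ⨆ i, f i := by rw [← Finset.sum_mul, hy.2, one_mul]

/-- Completing the square around the minimizer of `d ↦ p ⬝ᵥ d + ½ d ⬝ᵥ H *ᵥ d`. -/
theorem Matrix.IsSymm.dotProduct_add_half_eq {ι : Type*} [Fintype ι] {H : Matrix ι ι ℝ}
    (hH : H.IsSymm) {p c : ι → ℝ} (hc : H *ᵥ c = -p) (d : ι → ℝ) :
    p ⬝ᵥ d + (1 / 2) * (d ⬝ᵥ H *ᵥ d) =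
      (1 / 2) * (p ⬝ᵥ c) + (1 / 2) * ((d - c) ⬝ᵥ H *ᵥ (d - c)) := by
  have hsymm := hH.dotProduct_mulVec_comm c d
  simp only [mulVec_sub, dotProduct_sub, sub_dotProduct, hsymm, hc, dotProduct_neg,
    dotProduct_comm d p, dotProduct_comm c p]
  ring

/-- Strong duality for the QP pair: `d* = -W G y*` is the unique minimizer of
`φ(d) = max_i gᵢᵀd + ½ dᵀHd`, with optimal value `-½ (Gy*)ᵀW(Gy*)`. -/
theorem stmt_3 {n m : ℕ} (hm : 1 ≤ m) (H W : Matrix (Fin n) (Fin n) ℝ)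
    (hH : H.PosDef) (hW : W = H⁻¹) (G : Matrix (Fin n) (Fin m) ℝ)
    (ystar : Fin m → ℝ) (hy : ystar ∈ stdSimplex ℝ (Fin m))
    (hmin : ∀ y ∈ stdSimplex ℝ (Fin m),
      G.mulVec ystar ⬝ᵥ W.mulVec (G.mulVec ystar) ≤ G.mulVec y ⬝ᵥ W.mulVec (G.mulVec y))
    (dstar : Fin n → ℝ) (hd : dstar = -(W.mulVec (G.mulVec ystar)))
    (φ : (Fin n → ℝ) → ℝ)
    (hφ : ∀ d, φ d = (⨆ i : Fin m, Gᵀ i ⬝ᵥ d) + (1 / 2) * (d ⬝ᵥ H.mulVec d)) :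
    (∀ d, φ dstar ≤ φ d) ∧ (∀ d, φ d ≤ φ dstar → d = dstar) ∧
    φ dstar = -(1 / 2) * (G.mulVec ystar ⬝ᵥ W.mulVec (G.mulVec ystar)) := by
  have : Nonempty (Fin m) := ⟨⟨0, hm⟩⟩
  have hHs : H.IsSymm := hH.isHermitian
  have hWs : W.IsSymm := hW ▸ hH.inv.isHermitian
  set p := G *ᵥ ystar with hp
  have hc : H *ᵥ dstar = -p := by
    rw [hd, mulVec_neg, mulVec_mulVec, hW, mul_nonsing_inv _ hH.det_pos.ne'.isUnit, one_mulVec]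
  have hpd : p ⬝ᵥ dstar = -(p ⬝ᵥ W *ᵥ p) := by rw [hd, dotProduct_neg]
  have hlower (d : Fin n → ℝ) : -(1 / 2) * (p ⬝ᵥ W *ᵥ p) +
      (1 / 2) * ((d - dstar) ⬝ᵥ H *ᵥ (d - dstar)) ≤ φ d := by
    have hsup : p ⬝ᵥ d ≤ ⨆ i, Gᵀ i ⬝ᵥ d := by
      rw [hp, ← vecMul_transpose, ← dotProduct_mulVec]
      exact dotProduct_le_iSup_of_mem_stdSimplex hy (Gᵀ *ᵥ d)
    have hsq := hHs.dotProduct_add_half_eq hc d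
    rw [hφ]
    linarith
  have hupper : φ dstar ≤ -(1 / 2) * (p ⬝ᵥ W *ᵥ p) := by
    have hsup : ⨆ i, Gᵀ i ⬝ᵥ dstar ≤ -(p ⬝ᵥ W *ᵥ p) := by
      refine ciSup_le fun i => ?_
      have hmem : Gᵀ i ∈ G.mulVecLin '' stdSimplex ℝ (Fin m) :=
        ⟨Pi.single i 1, single_mem_stdSimplex ℝ i, mulVec_single_one G i⟩
      have hopt := hWs.le_dotProduct_mulVec_of_isMinOn
        ((convex_stdSimplex ℝ (Fin m)).linear_image G.mulVecLin) ⟨ystar, hy, rfl⟩ hmem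
        (by rintro _ ⟨y, hy', rfl⟩; exact hmin y hy')
      rw [hd, dotProduct_neg]
      exact neg_le_neg hopt
    rw [hφ, hc, dotProduct_neg, dotProduct_comm dstar, hpd]
    linarith
  have hquad (x : Fin n → ℝ) : 0 ≤ x ⬝ᵥ H *ᵥ x := by
    simpa using hH.posSemidef.dotProduct_mulVec_nonneg x
  refine ⟨fun d => ?_, fun d hle => ?_, le_antisymm hupper ?_⟩
  · linarith [hlower d, hquad (d - dstar)]
  · by_contra hne
    have hpos := hH.dotProduct_mulVec_pos (sub_ne_zero.2 hne)
    rw [star_trivial] at hpos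
    linarith [hlower d]
  · linarith [hlower dstar, hquad (dstar - dstar)]
end

section
/- Let H ∈ ℝ^{n×n} be symmetric positive definite, and let G ∈ ℝ^{n×m} (m ≥ 1) have columns g₁,…,g_m. Then the infimum over d ∈ ℝⁿ of φ(d) := max_{1≤i≤m} gᵢᵀd + ½dᵀHd equals 0 if and only if 0 ∈ conv{g₁,…,g_m}; if 0 ∉ conv{g₁,…,g_m}, this infimum is strictly negative. -/
open Matrix

theorem Matrix.PosDef.neg_half_le_dotProduct_add {ι : Type*} [Fintype ι] [DecidableEq ι]
    {H : Matrix ι ι ℝ} (hH : H.PosDef) (g d : ι → ℝ) :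
    -(1 / 2) * (g ⬝ᵥ H⁻¹ *ᵥ g) ≤ g ⬝ᵥ d + (1 / 2) * (d ⬝ᵥ H *ᵥ d) := by
  have hmul : H *ᵥ (H⁻¹ *ᵥ g) = g := by
    rw [mulVec_mulVec, mul_nonsing_inv _ ((isUnit_iff_isUnit_det _).1 hH.isUnit), one_mulVec]
  have hsymm : (H⁻¹ *ᵥ g) ⬝ᵥ H *ᵥ d = g ⬝ᵥ d := by
    have hT : Hᵀ = H := by simpa [conjTranspose_eq_transpose_of_trivial] using hH.isHermitian.eq
    rw [dotProduct_mulVec, ← mulVec_transpose, hT, hmul]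
  have h := hH.posSemidef.dotProduct_mulVec_nonneg (d + H⁻¹ *ᵥ g)
  simp only [star_trivial, mulVec_add, dotProduct_add, add_dotProduct, hmul, hsymm] at h
  rw [dotProduct_comm d g, dotProduct_comm (H⁻¹ *ᵥ g) g] at h
  linarith

theorem zero_le_iSup_dotProduct_of_mem_convexHull {ι κ : Type*} [Fintype ι] [Finite κ]
    {g : κ → ι → ℝ} (h0 : (0 : ι → ℝ) ∈ convexHull ℝ (Set.range g)) (d : ι → ℝ) :
    0 ≤ ⨆ i, g i ⬝ᵥ d := by
  have hconv : Convex ℝ {x : ι → ℝ | x ⬝ᵥ d ≤ ⨆ i, g i ⬝ᵥ d} :=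
    convex_halfSpace_le ⟨fun x y => add_dotProduct x y d, fun c x => smul_dotProduct c x d⟩ _
  have hsub : Set.range g ⊆ {x : ι → ℝ | x ⬝ᵥ d ≤ ⨆ i, g i ⬝ᵥ d} := by
    rintro _ ⟨i, rfl⟩
    exact le_ciSup (f := fun i => g i ⬝ᵥ d) (Set.finite_range _).bddAbove i
  simpa using convexHull_min hsub hconv h0

theorem exists_dotProduct_le_neg_of_zero_notMem_convexHull {ι κ : Type*} [Fintype ι] [Finite κ]
    {g : κ → ι → ℝ} (h0 : (0 : ι → ℝ) ∉ convexHull ℝ (Set.range g)) :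
    ∃ d : ι → ℝ, ∃ u > 0, ∀ i, g i ⬝ᵥ d ≤ -u := by
  classical
  obtain ⟨f, u, hu, hf⟩ := geometric_hahn_banach_point_closed (convex_convexHull ℝ _)
    ((Set.finite_range g).isClosed_convexHull ℝ) h0
  refine ⟨-fun j => f (Pi.single j 1), u, by simpa using hu, fun i => ?_⟩
  have hdot : g i ⬝ᵥ (fun j => f (Pi.single j 1)) = f (g i) := by
    conv_rhs => rw [pi_eq_sum_univ' (g i)]
    simp [dotProduct]
  rw [dotProduct_neg, hdot]
  exact neg_le_neg (hf _ (subset_convexHull ℝ _ ⟨i, rfl⟩)).le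

/-- The infimum over `d` of `φ(d) = max_i gᵢᵀd + ½ dᵀHd` equals `0` if and only if the
origin lies in the convex hull of the columns of `G`; otherwise the infimum is
strictly negative. -/
theorem stmt_4 {n m : ℕ} (hm : 1 ≤ m) (H : Matrix (Fin n) (Fin n) ℝ)
    (hH : H.PosDef) (G : Matrix (Fin n) (Fin m) ℝ)
    (φ : (Fin n → ℝ) → ℝ)
    (hφ : ∀ d, φ d = (⨆ i : Fin m, Gᵀ i ⬝ᵥ d) + (1 / 2) * (d ⬝ᵥ H.mulVec d)) :
    ((⨅ d : Fin n → ℝ, φ d) = 0 ↔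
      (0 : Fin n → ℝ) ∈ convexHull ℝ (Set.range fun i : Fin m => Gᵀ i)) ∧
    ((0 : Fin n → ℝ) ∉ convexHull ℝ (Set.range fun i : Fin m => Gᵀ i) →
      (⨅ d : Fin n → ℝ, φ d) < 0) := by
  have : Nonempty (Fin m) := ⟨⟨0, hm⟩⟩
  have hnn (d : Fin n → ℝ) : 0 ≤ d ⬝ᵥ H *ᵥ d := by
    simpa using hH.posSemidef.dotProduct_mulVec_nonneg d
  have hbdd : BddBelow (Set.range φ) := by
    let i₀ : Fin m := ⟨0, hm⟩
    refine ⟨-(1 / 2) * (Gᵀ i₀ ⬝ᵥ H⁻¹ *ᵥ Gᵀ i₀), ?_⟩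
    rintro _ ⟨d, rfl⟩
    have hsup := le_ciSup (f := fun i => Gᵀ i ⬝ᵥ d) (Set.finite_range _).bddAbove i₀
    have hlow := hH.neg_half_le_dotProduct_add (Gᵀ i₀) d
    rw [hφ]
    linarith
  have hneg (h0 : (0 : Fin n → ℝ) ∉ convexHull ℝ (Set.range fun i : Fin m => Gᵀ i)) :
      (⨅ d : Fin n → ℝ, φ d) < 0 := by
    obtain ⟨d, u, hu, hd⟩ := exists_dotProduct_le_neg_of_zero_notMem_convexHull h0
    have hq := hnn d
    set q := d ⬝ᵥ H *ᵥ d with hq_def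
    set t := u / (q + 1) with ht_def
    have ht : 0 < t := by positivity
    have htu : t * (q + 1) = u := by rw [ht_def]; field_simp
    refine (ciInf_le hbdd (t • d)).trans_lt ?_
    have hsup : (⨆ i : Fin m, Gᵀ i ⬝ᵥ (t • d)) ≤ t * -u :=
      ciSup_le fun i => by
        rw [dotProduct_smul, smul_eq_mul]
        exact mul_le_mul_of_nonneg_left (hd i) ht.le
    rw [hφ, mulVec_smul, dotProduct_smul, smul_dotProduct, ← hq_def, smul_eq_mul, smul_eq_mul]
    have h1 : 0 < t * t := by positivity
    have h2 : 0 ≤ t * t * q := by positivity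
    have h3 : t * -u = -(t * t * q) - t * t := by rw [← htu]; ring
    linarith
  refine ⟨⟨fun h => by_contra fun h0 => (hneg h0).ne h, fun h0 => ?_⟩, hneg⟩
  refine le_antisymm ((ciInf_le hbdd 0).trans_eq (by simp [hφ])) (le_ciInf fun d => ?_)
  rw [hφ]
  have hsup := zero_le_iSup_dotProduct_of_mem_convexHull h0 d
  have hq := hnn d
  positivity
end

section
/- Let H ∈ ℝ^{n×n} be symmetric positive definite with inverse W := H⁻¹, let G ∈ ℝ^{n×m}, define θ(y) := −½(Gy)ᵀW(Gy) and q(d,z) := z + ½dᵀHd, and let θ* := max_{y∈Δ_m} θ(y). Suppose θ* < 0 and let σ > 0 with τ := σ² + 2σ. If (d,z) ∈ ℝⁿ×ℝ satisfies Gᵀd ≤ z𝟙 componentwise and y ∈ Δ_m satisfies q(d,z) − θ(y) ≤ τ·(−q(d,z)), then 0 > θ(y) ≥ (1+σ)²·θ*. -/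
open Matrix

/-- The Fenchel-Young inequality for the quadratic form of a positive definite matrix. -/
theorem neg_half_dotProduct_inv_le {n : ℕ} {H : Matrix (Fin n) (Fin n) ℝ} (hH : H.PosDef)
    (u d : Fin n → ℝ) :
    -(1 / 2) * (u ⬝ᵥ H⁻¹ *ᵥ u) ≤ u ⬝ᵥ d + (1 / 2) * (d ⬝ᵥ H *ᵥ d) := by
  have hinv : H *ᵥ (H⁻¹ *ᵥ u) = u := by
    rw [mulVec_mulVec, mul_nonsing_inv _ ((isUnit_iff_isUnit_det _).mp hH.isUnit), one_mulVec]
  have hsymm : Hᵀ = H := by simpa using hH.isHermitian.eq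
  have hcross : (H⁻¹ *ᵥ u) ⬝ᵥ (H *ᵥ d) = u ⬝ᵥ d := by
    rw [dotProduct_mulVec, ← mulVec_transpose, hsymm, hinv]
  have hnonneg : 0 ≤ (d + H⁻¹ *ᵥ u) ⬝ᵥ (H *ᵥ (d + H⁻¹ *ᵥ u)) := by
    simpa using hH.posSemidef.dotProduct_mulVec_nonneg (d + H⁻¹ *ᵥ u)
  rw [mulVec_add, hinv, add_dotProduct, dotProduct_add, dotProduct_add, hcross,
    dotProduct_comm d u, dotProduct_comm (H⁻¹ *ᵥ u) u] at hnonneg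
  linarith

/-- A convex combination of quantities bounded by `z` is bounded by `z`. -/
theorem dotProduct_le_of_mem_stdSimplex {m : ℕ} {y v : Fin m → ℝ} {z : ℝ}
    (hy : y ∈ stdSimplex ℝ (Fin m)) (hv : ∀ i, v i ≤ z) : v ⬝ᵥ y ≤ z :=
  calc v ⬝ᵥ y ≤ ∑ i, z * y i :=
        Finset.sum_le_sum fun i _ => mul_le_mul_of_nonneg_right (hv i) (hy.1 i)
    _ = z := by rw [← Finset.mul_sum, hy.2, mul_one]

/-- Lemma 2.3: if the dual optimal value `θ* < 0` and the inexactness condition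
`q(d,z) - θ(y) ≤ τ (-q(d,z))` holds with `τ = σ² + 2σ` for a primal-feasible `(d,z)`
and a dual-feasible `y`, then `0 > θ(y) ≥ (1+σ)² θ*`. -/
theorem stmt_5 {n m : ℕ} (H W : Matrix (Fin n) (Fin n) ℝ) (hH : H.PosDef)
    (hW : W = H⁻¹) (G : Matrix (Fin n) (Fin m) ℝ)
    (θ : (Fin m → ℝ) → ℝ)
    (hθ : ∀ y, θ y = -(1 / 2) * (G.mulVec y ⬝ᵥ W.mulVec (G.mulVec y)))
    (q : (Fin n → ℝ) → ℝ → ℝ)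
    (hq : ∀ d z, q d z = z + (1 / 2) * (d ⬝ᵥ H.mulVec d))
    (θstar : ℝ) (hmax : IsGreatest (θ '' stdSimplex ℝ (Fin m)) θstar)
    (hneg : θstar < 0) (σ : ℝ) (hσ : 0 < σ) (τ : ℝ) (hτ : τ = σ ^ 2 + 2 * σ)
    (d : Fin n → ℝ) (z : ℝ) (hdz : ∀ i, Gᵀ.mulVec d i ≤ z)
    (y : Fin m → ℝ) (hy : y ∈ stdSimplex ℝ (Fin m))
    (hcond : q d z - θ y ≤ τ * (-(q d z))) :
    θ y < 0 ∧ (1 + σ) ^ 2 * θstar ≤ θ y := by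
  have hweak : θstar ≤ q d z := by
    obtain ⟨w, hw, rfl⟩ := hmax.1
    have hz := dotProduct_le_of_mem_stdSimplex hw hdz
    rw [mulVec_transpose, ← dotProduct_mulVec, dotProduct_comm] at hz
    have hquad := neg_half_dotProduct_inv_le hH (G *ᵥ w) d
    rw [hθ, hq, hW]
    linarith
  refine ⟨(hmax.2 ⟨y, hy, rfl⟩).trans_lt hneg, ?_⟩
  calc (1 + σ) ^ 2 * θstar ≤ (1 + σ) ^ 2 * q d z := by gcongr
    _ ≤ θ y := by rw [hτ] at hcond; linarith
end

section
/- Let H ∈ ℝ^{n×n} be symmetric positive definite with inverse W := H⁻¹, let G ∈ ℝ^{n×m}, define θ(y) := −½(Gy)ᵀW(Gy) and q(d,z) := z + ½dᵀHd, and let θ* := max_{y∈Δ_m} θ(y). Suppose θ* < 0, let σ > 0 and ρ ∈ (0,1), let (d,z) ∈ ℝⁿ×ℝ satisfy Gᵀd ≤ z𝟙 componentwise with q := q(d,z) < 0, and let y₀, y ∈ Δ_m with θ(y₀) < q. Define λ := max{1 − (σ²+2σ)/(θ(y₀)/q − 1), ρ}. If θ(y) − θ(y₀) ≥ λ·(q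 − θ(y₀)), then 0 > θ(y) ≥ (1+σ)²·θ*. -/
open Matrix

/-- Fenchel–Young inequality for the quadratic form of a positive definite matrix. -/
theorem Matrix.PosDef.neg_half_inv_quadratic_le {ι : Type*} [Fintype ι] [DecidableEq ι]
    {H : Matrix ι ι ℝ} (hH : H.PosDef) (d v : ι → ℝ) :
    -(1 / 2) * (v ⬝ᵥ H⁻¹ *ᵥ v) ≤ d ⬝ᵥ v + (1 / 2) * (d ⬝ᵥ H *ᵥ d) := by
  have hnonneg : 0 ≤ (d + H⁻¹ *ᵥ v) ⬝ᵥ H *ᵥ (d + H⁻¹ *ᵥ v) := by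
    simpa using hH.posSemidef.dotProduct_mulVec_nonneg (d + H⁻¹ *ᵥ v)
  have hcancel : H *ᵥ (H⁻¹ *ᵥ v) = v := by
    rw [mulVec_mulVec, mul_nonsing_inv _ ((isUnit_iff_isUnit_det _).mp hH.isUnit), one_mulVec]
  have hsymm : Hᵀ = H := by simpa using hH.isHermitian.eq
  have hcross : (H⁻¹ *ᵥ v) ⬝ᵥ H *ᵥ d = d ⬝ᵥ v := by
    rw [dotProduct_mulVec, ← mulVec_transpose, hsymm, hcancel, dotProduct_comm]
  rw [mulVec_add, hcancel, add_dotProduct, dotProduct_add, dotProduct_add, hcross,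
    dotProduct_comm (H⁻¹ *ᵥ v) v] at hnonneg
  linarith

/-- A weighted average of numbers bounded by `z` is bounded by `z`. -/
theorem dotProduct_le_of_mem_stdSimplex_s6 {ι : Type*} [Fintype ι] {y c : ι → ℝ} {z : ℝ}
    (hy : y ∈ stdSimplex ℝ ι) (hc : ∀ i, c i ≤ z) : c ⬝ᵥ y ≤ z :=
  calc c ⬝ᵥ y ≤ ∑ i, z * y i :=
        Finset.sum_le_sum fun i _ => mul_le_mul_of_nonneg_right (hc i) (hy.1 i)
    _ = z := by rw [← Finset.mul_sum, hy.2, mul_one]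

/-- Lemma 2.4: if the dual optimal value `θ* < 0`, `(d,z)` is primal feasible with
`q := q(d,z) < 0`, `y₀, y` are dual feasible with `θ(y₀) < q`, and
`θ(y) - θ(y₀) ≥ λ (q - θ(y₀))` with `λ = max{1 - (σ²+2σ)/(θ(y₀)/q - 1), ρ}`,
then `0 > θ(y) ≥ (1+σ)² θ*`. -/
theorem stmt_6 {n m : ℕ} (H W : Matrix (Fin n) (Fin n) ℝ) (hH : H.PosDef)
    (hW : W = H⁻¹) (G : Matrix (Fin n) (Fin m) ℝ)
    (θ : (Fin m → ℝ) → ℝ)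
    (hθ : ∀ y, θ y = -(1 / 2) * (G.mulVec y ⬝ᵥ W.mulVec (G.mulVec y)))
    (q : (Fin n → ℝ) → ℝ → ℝ)
    (hq : ∀ d z, q d z = z + (1 / 2) * (d ⬝ᵥ H.mulVec d))
    (θstar : ℝ) (hmax : IsGreatest (θ '' stdSimplex ℝ (Fin m)) θstar)
    (hneg : θstar < 0) (σ ρ : ℝ) (hσ : 0 < σ) (hρ : ρ ∈ Set.Ioo (0 : ℝ) 1)
    (d : Fin n → ℝ) (z : ℝ) (hdz : ∀ i, Gᵀ.mulVec d i ≤ z) (hqneg : q d z < 0)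
    (y₀ y : Fin m → ℝ) (hy₀ : y₀ ∈ stdSimplex ℝ (Fin m)) (hy : y ∈ stdSimplex ℝ (Fin m))
    (hθy₀ : θ y₀ < q d z)
    (lam : ℝ) (hlam : lam = max (1 - (σ ^ 2 + 2 * σ) / (θ y₀ / q d z - 1)) ρ)
    (hcond : θ y - θ y₀ ≥ lam * (q d z - θ y₀)) :
    θ y < 0 ∧ (1 + σ) ^ 2 * θstar ≤ θ y := by
  have hweak : θstar ≤ q d z := by
    obtain ⟨x, hx, rfl⟩ := hmax.1
    have hquad := hH.neg_half_inv_quadratic_le d (G *ᵥ x)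
    have hlin := dotProduct_le_of_mem_stdSimplex_s6 hx hdz
    rw [mulVec_transpose, ← dotProduct_mulVec] at hlin
    rw [hθ, hq, hW]
    linarith
  refine ⟨(hmax.2 ⟨y, hy, rfl⟩).trans_lt hneg, ?_⟩
  have hlam_le : 1 - (σ ^ 2 + 2 * σ) / (θ y₀ / q d z - 1) ≤ lam := hlam ▸ le_max_left _ _
  have hgap : 0 < q d z - θ y₀ := sub_pos.mpr hθy₀
  have hmul := mul_le_mul_of_nonneg_right hlam_le hgap.le
  have hsimp : (1 - (σ ^ 2 + 2 * σ) / (θ y₀ / q d z - 1)) * (q d z - θ y₀) =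
      (1 + σ) ^ 2 * q d z - θ y₀ := by
    have hq0 : q d z ≠ 0 := hqneg.ne
    have hgap' : θ y₀ - q d z ≠ 0 := (sub_neg.mpr hθy₀).ne
    rw [div_sub_one hq0]
    field_simp
    ring
  have hscale := mul_le_mul_of_nonneg_left hweak (sq_nonneg (1 + σ))
  linarith
end

section
/- Let x, x⁺, d, u ∈ ℝⁿ, let α ≥ 0, ε > 0, and η ∈ (0,1), and let a, a⁺ ∈ ℝ. Suppose the sufficient-decrease inequality a − a⁺ ≥ η·α·max{‖d‖₂², ‖u‖₂²} and the perturbation bound ‖x + αd − x⁺‖₂ ≤ min{α, ε}·min{‖d‖₂, ‖u‖₂} both hold. Then a⁺ ≤ a − ½·η·‖x⁺ − x‖₂·max{‖d‖₂, ‖u‖₂}. -/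
/-- Lemma 2.7: if the sufficient-decrease inequality
`a - a⁺ ≥ η α max{‖d‖², ‖u‖²}` and the perturbation bound
`‖x + αd - x⁺‖ ≤ min{α, ε} min{‖d‖, ‖u‖}` hold, then
`a⁺ ≤ a - ½ η ‖x⁺ - x‖ max{‖d‖, ‖u‖}`. -/
theorem stmt_9 {n : ℕ} (x xplus d u : EuclideanSpace ℝ (Fin n))
    (α ε η : ℝ) (hα : 0 ≤ α) (hε : 0 < ε) (hη : η ∈ Set.Ioo (0 : ℝ) 1)
    (a aplus : ℝ)
    (hdec : a - aplus ≥ η * α * max (‖d‖ ^ 2) (‖u‖ ^ 2))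
    (hpert : ‖x + α • d - xplus‖ ≤ min α ε * min ‖d‖ ‖u‖) :
    aplus ≤ a - (1 / 2) * η * ‖xplus - x‖ * max ‖d‖ ‖u‖ := by
  have hη0 : 0 ≤ η := hη.1.le
  set M := max ‖d‖ ‖u‖ with hM
  have hdM : ‖d‖ ≤ M := le_max_left _ _
  have hM0 : 0 ≤ M := (norm_nonneg d).trans hdM
  have hsq : M ^ 2 ≤ max (‖d‖ ^ 2) (‖u‖ ^ 2) := by
    rcases max_choice ‖d‖ ‖u‖ with h | h
    · rw [hM, h]; exact le_max_left _ _
    · rw [hM, h]; exact le_max_right _ _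
  have hpertM : ‖x + α • d - xplus‖ ≤ α * M :=
    hpert.trans <| mul_le_mul (min_le_left _ _) ((min_le_left _ _).trans hdM)
      (le_min (norm_nonneg _) (norm_nonneg _)) hα
  have hstep : ‖xplus - x‖ ≤ 2 * (α * M) :=
    calc ‖xplus - x‖ = ‖α • d - (x + α • d - xplus)‖ := by congr 1; abel
      _ ≤ ‖α • d‖ + ‖x + α • d - xplus‖ := norm_sub_le _ _
      _ ≤ α * M + α * M := by
        rw [norm_smul, Real.norm_of_nonneg hα]
        gcongr
      _ = 2 * (α * M) := by ring
  have hprod : (1 / 2) * η * ‖xplus - x‖ * M ≤ η * α * max (‖d‖ ^ 2) (‖u‖ ^ 2) :=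
    calc (1 / 2) * η * ‖xplus - x‖ * M ≤ (1 / 2) * η * (2 * (α * M)) * M := by gcongr
      _ = η * α * M ^ 2 := by ring
      _ ≤ η * α * max (‖d‖ ^ 2) (‖u‖ ^ 2) := by gcongr
  linarith
end

section
/- Let f : ℝⁿ → ℝ be locally Lipschitz on ℝⁿ and continuously differentiable on an open set D ⊆ ℝⁿ whose complement has Lebesgue measure zero. Let W ∈ ℝ^{n×n} be symmetric positive definite, let ε > 0, ω > 0, x̄ ∈ ℝⁿ, and let p ∈ ℕ with p ≥ n + 1. Then there exists ζ > 0 such that for every x ∈ ℝⁿ with ‖x − x̄‖₂ ≤ ζ, there exists a nonempty open set T ⊆ (ℝⁿ)^{p+1} such that every tuple (x₀, x₁, …, x_p) ∈ T satisfies xᵢ ∈ B(x, ε) ∩ D for all i ∈ {0,…,p} and inf{‖u‖_W : u ∈ conv{∇f(x₀), ∇f(x₁), …, ∇f(x_p)}} ≤ inf{‖u‖_W : u ∈ cl conv ∇f(B(x̄, ε) ∩ D)} + ω. -/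
open Matrix

/-- Carathéodory's theorem with a prescribed index type of sufficiently large cardinality. -/
theorem exists_convexCombination_of_finrank_lt_card {E κ : Type*} [AddCommGroup E] [Module ℝ E]
    [FiniteDimensional ℝ E] [Fintype κ] (hκ : Module.finrank ℝ E < Fintype.card κ)
    {s : Set E} {u : E} (hu : u ∈ convexHull ℝ s) :
    ∃ (w : κ → ℝ) (z : κ → E), (∀ i, 0 ≤ w i) ∧ ∑ i, w i = 1 ∧ (∀ i, z i ∈ s) ∧
      ∑ i, w i • z i = u := by
  obtain ⟨ι, _, z, w, hz, hind, hw, hw1, hsum⟩ := eq_pos_convex_span_of_mem_convexHull hu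
  have hcard : Fintype.card ι ≤ Fintype.card κ :=
    (hind.card_le_finrank_succ.trans (Nat.succ_le_succ (Submodule.finrank_le _))).trans hκ
  obtain ⟨e⟩ := Function.Embedding.nonempty_of_card_le hcard
  obtain ⟨a, ha⟩ := convexHull_nonempty_iff.1 ⟨u, hu⟩
  have hw0 : ∀ i ∉ Set.range e, Function.extend e w 0 i = 0 := fun i hi =>
    Function.extend_apply' _ _ _ hi
  refine ⟨Function.extend e w 0, Function.extend e z fun _ => a, fun i => ?_, ?_, fun i => ?_, ?_⟩
  · by_cases hi : i ∈ Set.range e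
    · obtain ⟨k, rfl⟩ := hi
      rw [e.injective.extend_apply]
      exact (hw k).le
    · exact (hw0 i hi).ge
  · rw [← hw1]
    exact (Fintype.sum_of_injective e e.injective _ _ hw0
      fun k => (e.injective.extend_apply _ _ k).symm).symm
  · by_cases hi : i ∈ Set.range e
    · obtain ⟨k, rfl⟩ := hi
      rw [e.injective.extend_apply]
      exact hz ⟨k, rfl⟩
    · rwa [Function.extend_apply' _ _ _ hi]
  · rw [← hsum]
    refine (Fintype.sum_of_injective e e.injective _ _ (fun i hi => ?_) fun k => ?_).symm
    · rw [hw0 i hi, zero_smul]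
    · rw [e.injective.extend_apply, e.injective.extend_apply]

/-- The gradient of a `C¹` function on an open set is continuous on that set. -/
theorem ContDiffOn.continuousOn_gradient_of_isOpen {F : Type*} [NormedAddCommGroup F]
    [InnerProductSpace ℝ F] [CompleteSpace F] {f : F → ℝ} {D : Set F}
    (hf : ContDiffOn ℝ 1 f D) (hD : IsOpen D) : ContinuousOn (gradient f) D :=
  (InnerProductSpace.toDual ℝ F).symm.continuous.comp_continuousOn
    (hf.continuousOn_fderiv_of_isOpen hD le_rfl)

/-- If the values of `g`, continuous on the open set `D`, at points of `closedBall a ε ∩ D` have a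
convex combination at which the nonnegative continuous `φ` is less than `c`, then for all `x`
near `a` the same holds for an open set of tuples in `closedBall x ε ∩ D`. -/
theorem exists_isOpen_sInf_image_convexHull_lt {E F κ : Type*} [NormedAddCommGroup E]
    [NormedSpace ℝ E] [AddCommGroup F] [Module ℝ F] [TopologicalSpace F] [ContinuousAdd F]
    [ContinuousConstSMul ℝ F] [FiniteDimensional ℝ F] [Fintype κ]
    (hκ : Module.finrank ℝ F < Fintype.card κ) {g : E → F} {D : Set E} (hD : IsOpen D)
    (hg : ContinuousOn g D) {φ : F → ℝ} (hφ : Continuous φ) (hφ0 : ∀ u, 0 ≤ φ u) {a : E}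
    {ε c : ℝ} (hε : 0 < ε) {u : F} (hu : u ∈ convexHull ℝ (g '' (Metric.closedBall a ε ∩ D)))
    (huc : φ u < c) :
    ∃ ζ > (0 : ℝ), ∀ x : E, ‖x - a‖ ≤ ζ → ∃ T : Set (κ → E), T.Nonempty ∧ IsOpen T ∧
      ∀ X ∈ T, (∀ i, X i ∈ Metric.closedBall x ε ∩ D) ∧
        sInf (φ '' convexHull ℝ (Set.range fun i => g (X i))) < c := by
  obtain ⟨w, z, hw0, hw1, hz, hsum⟩ := exists_convexCombination_of_finrank_lt_card hκ hu
  choose y hy hyz using hz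
  have hcont : ContinuousOn (fun X : κ → E => φ (∑ i, w i • g (X i)))
      (Set.univ.pi fun _ => D) := by
    refine hφ.comp_continuousOn (continuousOn_finsetSum _ fun i _ => ContinuousOn.const_smul ?_ _)
    exact hg.comp (continuous_apply i).continuousOn fun X hX => hX i trivial
  have hU := hcont.isOpen_inter_preimage (isOpen_set_pi Set.finite_univ fun _ _ => hD)
    (isOpen_Iio (a := c))
  set U := (Set.univ.pi fun _ => D) ∩
    (fun X : κ → E => φ (∑ i, w i • g (X i))) ⁻¹' Set.Iio c with hUdef
  have hyU : y ∈ U := by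
    refine ⟨fun i _ => (hy i).2, ?_⟩
    simpa [hyz, hsum] using huc
  have hycl : y ∈ closure (Set.univ.pi fun _ : κ => Metric.ball a ε) := by
    rw [closure_pi_set, closure_ball a hε.ne']
    exact fun i _ => (hy i).1
  obtain ⟨v, hvU, hv⟩ := mem_closure_iff.1 hycl U hU hyU
  have hev : ∀ᶠ x in nhds a, ∀ i, v i ∈ Metric.ball x ε := by
    refine Filter.eventually_all.2 fun i => ?_
    filter_upwards [(continuous_const.dist continuous_id).continuousAt.eventually_lt
      continuousAt_const (Metric.mem_ball.1 (hv i trivial))] with x hx using hx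
  obtain ⟨ζ, hζ, hball⟩ := Metric.nhds_basis_closedBall.eventually_iff.1 hev
  refine ⟨ζ, hζ, fun x hx => ⟨U ∩ Set.univ.pi fun _ => Metric.ball x ε,
    ⟨v, hvU, fun i _ => hball (mem_closedBall_iff_norm.2 hx) i⟩,
    hU.inter (isOpen_set_pi Set.finite_univ fun _ _ => Metric.isOpen_ball), fun X hX =>
    ⟨fun i => ⟨Metric.ball_subset_closedBall (hX.2 i trivial), hX.1.1 i trivial⟩, ?_⟩⟩⟩
  refine lt_of_le_of_lt (csInf_le ⟨0, ?_⟩ (Set.mem_image_of_mem φ ?_)) hX.1.2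
  · rintro _ ⟨b, -, rfl⟩
    exact hφ0 b
  · exact mem_convexHull_of_exists_fintype w _ hw0 hw1 (fun i => Set.mem_range_self i) rfl

/-- Lemma 2.8 (sampling lemma): for `f` locally Lipschitz and continuously
differentiable on a full-measure open set `D`, a symmetric positive definite `W`,
`ε, ω > 0`, a point `x̄` and `p ≥ n + 1`, there exists `ζ > 0` such that whenever
`‖x - x̄‖ ≤ ζ` there is a nonempty open set `T` of `(p+1)`-tuples of sample points, each
tuple lying in `B(x, ε) ∩ D` with the minimal `W`-norm over the convex hull of its
gradients at most `ω` larger than the minimal `W`-norm over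
`cl conv ∇f(B(x̄, ε) ∩ D)`. -/
theorem stmt_10 {n : ℕ} (f : EuclideanSpace ℝ (Fin n) → ℝ)
    (D : Set (EuclideanSpace ℝ (Fin n)))
    (hlip : LocallyLipschitz f) (hD : IsOpen D) (hf : ContDiffOn ℝ 1 f D)
    (hmeas : MeasureTheory.volume Dᶜ = 0)
    (W : Matrix (Fin n) (Fin n) ℝ) (hW : W.PosDef)
    (ε ω : ℝ) (hε : 0 < ε) (hω : 0 < ω) (xbar : EuclideanSpace ℝ (Fin n))
    (p : ℕ) (hp : n + 1 ≤ p) :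
    ∃ ζ > (0 : ℝ), ∀ x : EuclideanSpace ℝ (Fin n), ‖x - xbar‖ ≤ ζ →
      ∃ T : Set (Fin (p + 1) → EuclideanSpace ℝ (Fin n)), T.Nonempty ∧ IsOpen T ∧
        ∀ X ∈ T, (∀ i, X i ∈ Metric.closedBall x ε ∩ D) ∧
          sInf ((fun u : EuclideanSpace ℝ (Fin n) =>
              Real.sqrt ((fun j => u j) ⬝ᵥ W.mulVec fun j => u j)) ''
            convexHull ℝ (Set.range fun i => gradient f (X i)))
          ≤ sInf ((fun u : EuclideanSpace ℝ (Fin n) =>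
              Real.sqrt ((fun j => u j) ⬝ᵥ W.mulVec fun j => u j)) ''
            closure (convexHull ℝ (gradient f '' (Metric.closedBall xbar ε ∩ D)))) + ω := by
  set φ := fun u : EuclideanSpace ℝ (Fin n) =>
    Real.sqrt ((fun j => u j) ⬝ᵥ W.mulVec fun j => u j) with hφdef
  have hφ : Continuous φ := by
    simp only [hφdef, dotProduct, mulVec]
    fun_prop
  set S := gradient f '' (Metric.closedBall xbar ε ∩ D)
  have hS : S.Nonempty := by
    have hdense : Dense D := MeasureTheory.Measure.dense_of_ae (p := (· ∈ D)) hmeas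
    obtain ⟨y, hy, hyD⟩ := hdense.inter_open_nonempty _ Metric.isOpen_ball
      (Metric.nonempty_ball.2 hε : (Metric.ball xbar ε).Nonempty)
    exact ⟨_, y, ⟨Metric.ball_subset_closedBall hy, hyD⟩, rfl⟩
  obtain ⟨_, ⟨b, hb, rfl⟩, hbc⟩ := exists_lt_of_csInf_lt
    ((hS.convexHull (𝕜 := ℝ)).closure.image φ) (lt_add_of_pos_right _ hω)
  obtain ⟨u, huc, hu⟩ := mem_closure_iff.1 hb _ (isOpen_Iio.preimage hφ) hbc
  obtain ⟨ζ, hζ, h⟩ := exists_isOpen_sInf_image_convexHull_lt (κ := Fin (p + 1))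
    (by simp only [finrank_euclideanSpace, Fintype.card_fin]; omega) hD
    (hf.continuousOn_gradient_of_isOpen hD) hφ (fun _ => Real.sqrt_nonneg _) hε hu huc
  refine ⟨ζ, hζ, fun x hx => ?_⟩
  obtain ⟨T, hT, hTo, hTX⟩ := h x hx
  exact ⟨T, hT, hTo, fun X hX => ⟨(hTX X hX).1, (hTX X hX).2.le⟩⟩
end
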